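/- Let n ≥ 1, β > 0, and let p > q be positive odd integers with 1 < p/q < 2. Let ĩ : ℝ → ℝⁿ be differentiable with ĩ_i'(t) = -β·sgn(ĩ_i(t))·|ĩ_i(t)|^{q/p} for every component i and all t ≥ 0. Then ĩ(t) = 0 for all t ≥ (p/(β·(p-q)))·max_i |ĩ_i(0)|^{1 - q/p}. -/

import Mathlib

theorem mul_real_sign_eq_abs (x : ℝ) : x * Real.sign x = |x| := by
  rcases lt_trichotomy x 0 with h | h | h
  · rw [Real.sign_of_neg h, abs_of_neg h]; ring
  · simp [h]
  · rw [Real.sign_of_pos h, abs_of_pos h]; ring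

theorem hasDerivAt_abs_real_sign {x : ℝ} (hx : x ≠ 0) : HasDerivAt (|·|) (Real.sign x) x := by
  rcases lt_or_gt_of_ne hx with h | h
  · rw [Real.sign_of_neg h]; exact hasDerivAt_abs_neg h
  · rw [Real.sign_of_pos h]; exact hasDerivAt_abs_pos h

/-- Solutions of `x' = -β sgn(x) |x| ^ a` have nonincreasing square. -/
theorem sq_antitoneOn_of_signed_power_ode {β a : ℝ} (hβ : 0 < β) {x : ℝ → ℝ}
    (hode : ∀ t, 0 ≤ t → HasDerivAt x (-β * Real.sign (x t) * |x t| ^ a) t) :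
    AntitoneOn (fun t => x t ^ 2) (Set.Ici 0) := by
  have hd : ∀ t, 0 ≤ t → HasDerivAt (fun t => x t ^ 2) (-(2 * β * (|x t| * |x t| ^ a))) t := by
    intro t ht
    refine ((hode t ht).pow 2).congr_deriv ?_
    rw [← mul_real_sign_eq_abs (x t)]
    push_cast
    ring
  refine antitoneOn_of_deriv_nonpos (convex_Ici 0)
    (fun t ht => (hd t ht).continuousAt.continuousWithinAt)
    (fun t ht => (hd t (interior_subset ht)).differentiableAt.differentiableWithinAt) ?_
  intro t ht
  rw [(hd t (interior_subset ht)).deriv, neg_nonpos]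
  positivity

/-- Solutions of `x' = -β sgn(x) |x| ^ a` vanish at every time `T` with
`|x 0| ^ (1 - a) ≤ β (1 - a) T`. -/
theorem eq_zero_of_signed_power_ode {β a : ℝ} (hβ : 0 < β) {x : ℝ → ℝ}
    (hode : ∀ t, 0 ≤ t → HasDerivAt x (-β * Real.sign (x t) * |x t| ^ a) t)
    {T : ℝ} (hT0 : 0 ≤ T) (hT : |x 0| ^ (1 - a) ≤ β * (1 - a) * T) : x T = 0 := by
  by_contra hne
  have hnz : ∀ t ∈ Set.Icc 0 T, x t ≠ 0 := by
    intro t ht h0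
    have h := sq_antitoneOn_of_signed_power_ode hβ hode (Set.mem_Ici.2 ht.1)
      (Set.mem_Ici.2 hT0) ht.2
    simp only [h0] at h
    have : 0 < x T ^ 2 := by positivity
    linarith
  have hd : ∀ t ∈ Set.Icc 0 T,
      HasDerivAt (fun t => |x t| ^ (1 - a) + β * (1 - a) * t) 0 t := by
    intro t ht
    have hx := hnz t ht
    have hpos : 0 < |x t| := abs_pos.2 hx
    have habs : HasDerivAt (fun t => |x t|) _ t :=
      (hasDerivAt_abs_real_sign hx).comp t (hode t ht.1)
    have hsum := (habs.rpow_const (p := 1 - a) (Or.inl hpos.ne')).add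
      ((hasDerivAt_id t).const_mul (β * (1 - a)))
    refine hsum.congr_deriv ?_
    have hs : Real.sign (x t) * Real.sign (x t) = 1 := by
      rcases Real.sign_apply_eq_of_ne_zero (x t) hx with h | h <;> rw [h] <;> norm_num
    have hp : |x t| ^ a * |x t| ^ (1 - a - 1) = 1 := by
      rw [← Real.rpow_add hpos]; simp
    linear_combination
      -(β * (1 - a)) * hs * (|x t| ^ a * |x t| ^ (1 - a - 1)) - β * (1 - a) * hp
  have hanti := antitoneOn_of_deriv_nonpos (convex_Icc 0 T)
    (fun t ht => (hd t ht).continuousAt.continuousWithinAt)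
    (fun t ht => (hd t (interior_subset ht)).differentiableAt.differentiableWithinAt)
    (fun t ht => (hd t (interior_subset ht)).deriv.le)
    (Set.left_mem_Icc.2 hT0) (Set.right_mem_Icc.2 hT0) hT0
  have hVT : 0 < |x T| ^ (1 - a) := Real.rpow_pos_of_pos (abs_pos.2 hne) _
  simp only [mul_zero, add_zero] at hanti
  linarith

theorem current_sliding_finite_time
    (n : ℕ) (hn : 1 ≤ n) (β : ℝ) (hβ : 0 < β)
    (p q : ℕ) (hp : Odd p) (hq : Odd q) (hq0 : 0 < q) (hqp : q < p)
    (hratio1 : 1 < (p : ℝ) / q) (hratio2 : (p : ℝ) / q < 2)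
    (i : ℝ → Fin n → ℝ)
    (hdiff : ∀ k : Fin n, Differentiable ℝ fun t => i t k)
    (hode : ∀ k : Fin n, ∀ t : ℝ, 0 ≤ t →
      deriv (fun τ => i τ k) t = -β * Real.sign (i t k) * |i t k| ^ ((q : ℝ) / p)) :
    ∀ t : ℝ,
      ((p : ℝ) / (β * ((p : ℝ) - q))) *
          (Finset.univ.sup' (Finset.univ_nonempty_iff.mpr ⟨⟨0, hn⟩⟩)
            fun k : Fin n => |i 0 k| ^ (1 - (q : ℝ) / p)) ≤ t →
      i t = 0 := by
  intro t ht
  funext k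
  have hqpR : (q : ℝ) < p := by exact_mod_cast hqp
  have hpR : (0 : ℝ) < p := by exact_mod_cast hq0.trans hqp
  have hsub : (0 : ℝ) < (p : ℝ) - q := sub_pos.2 hqpR
  have hc : 0 < (p : ℝ) / (β * ((p : ℝ) - q)) := by positivity
  have hk : ((p : ℝ) / (β * ((p : ℝ) - q))) * |i 0 k| ^ (1 - (q : ℝ) / p) ≤ t :=
    (mul_le_mul_of_nonneg_left
      (Finset.le_sup' (fun k : Fin n => |i 0 k| ^ (1 - (q : ℝ) / p)) (Finset.mem_univ k))
      hc.le).trans ht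
  have ht0 : 0 ≤ t := le_trans (by positivity) hk
  refine eq_zero_of_signed_power_ode (x := fun t => i t k) (a := (q : ℝ) / p) hβ
    (fun s hs => ?_) ht0 ?_
  · rw [← hode k s hs]
    exact (hdiff k s).hasDerivAt
  · have hcoef : β * (1 - (q : ℝ) / p) = ((p : ℝ) / (β * ((p : ℝ) - q)))⁻¹ := by
      field_simp
    rw [hcoef]
    exact (le_inv_mul_iff₀ hc).2 hk
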